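/- Let f ∈ C_c(ℝ^d × ℤ^m) with f not identically zero. Then the zero set U = {(x, y+ℤ^m) ∈ ℝ^d × 𝕋^m : f̂(x, y+ℤ^m) = 0} of its Fourier transform has Haar measure zero in ℝ^d × 𝕋^m. -/

import Mathlib

open MeasureTheory

lemma aux_null {E : Type*} [NormedAddCommGroup E] [NormedSpace ℝ E] [FiniteDimensional ℝ E]
    [MeasurableSpace E] [BorelSpace E] (μ : Measure E) [μ.IsAddHaarMeasure]
    (g : E → ℂ) (hg : Continuous g) (x0 : E) (h0 : g x0 ≠ 0)
    (hline : ∀ x, ∀ t : ℝ, AnalyticAt ℝ (fun t : ℝ => g (x0 + t • x)) t) :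
    μ {p | g p = 0} = 0 := by
  have hae : ∀ x, ∀ᵐ t : ℝ, g (x0 + t • x) ≠ 0 := by
    intro x
    have hA : AnalyticOnNhd ℝ (fun t : ℝ => g (x0 + t • x)) Set.univ := fun t _ => hline x t
    rcases hA.eqOn_zero_or_eventually_ne_zero_of_preconnected isPreconnected_univ with h | h
    · exact absurd (by simpa using h (Set.mem_univ (0:ℝ))) h0
    · have := ae_restrict_le_codiscreteWithin (μ := (volume : Measure ℝ)) MeasurableSet.univ h
      simpa [Filter.Eventually, Measure.restrict_univ] using this
  set W : Set E := {x | g (x0 + x) = 0} with hW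
  have hWm : MeasurableSet W :=
    (isClosed_singleton.preimage (hg.comp (continuous_const.add continuous_id))).measurableSet
  have hcl : MeasurableSet {q : E × ℝ | g (x0 + q.2 • q.1) = 0} :=
    (isClosed_singleton.preimage (f := fun q : E × ℝ => g (x0 + q.2 • q.1))
      (hg.comp (by fun_prop))).measurableSet
  have h1 : ∀ᵐ t : ℝ, ∀ᵐ x ∂μ, g (x0 + t • x) ≠ 0 := by
    have := (Measure.ae_ae_comm (μ := μ) (ν := (volume : Measure ℝ))
      (p := fun x t => g (x0 + t • x) ≠ 0) hcl.compl).1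
      (Filter.Eventually.of_forall hae)
    exact this
  have h2 : ∀ᵐ t : ℝ, t ≠ 0 := by simp [ae_iff]
  obtain ⟨t, ht, ht0⟩ := (h1.and h2).exists
  have h3 : μ ((t • ·) ⁻¹' W) = 0 := by
    rw [ae_iff] at ht
    simpa [hW] using ht
  rw [Measure.addHaar_preimage_smul μ ht0] at h3
  have h4 : μ W = 0 := by
    rcases mul_eq_zero.1 h3 with h | h
    · exfalso
      rw [ENNReal.ofReal_eq_zero] at h
      have : 0 < |(t ^ Module.finrank ℝ E)⁻¹| := by positivity
      linarith
    · exact h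
  have h5 : W = (fun x => x0 + x) ⁻¹' {p | g p = 0} := rfl
  rwa [h5, measure_preimage_add] at h4

lemma aux_diff {d : ℕ} (f : (Fin d → ℝ) → ℂ) (hf : Continuous f) (hs : HasCompactSupport f)
    (α β : (Fin d → ℝ) → ℝ) (hα : Continuous α) (hβ : Continuous β) :
    Differentiable ℂ (fun z : ℂ => ∫ u, Complex.exp (-2 * Real.pi * (α u + z * β u) * Complex.I)
      * f u) := by
  intro z0
  have key := hasDerivAt_integral_of_dominated_loc_of_deriv_le (𝕜 := ℂ)
    (μ := (volume : Measure (Fin d → ℝ)))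
    (F := fun z u => Complex.exp (-2 * Real.pi * (α u + z * β u) * Complex.I) * f u)
    (F' := fun z u => (Complex.exp (-2 * Real.pi * (α u + z * β u) * Complex.I) *
       (-2 * Real.pi * β u * Complex.I)) * f u)
    (bound := fun u => Real.exp (2 * Real.pi * (|β u| * (‖z0‖ + 1))) * (2 * Real.pi * |β u|) * ‖f u‖)
    (s := Metric.ball z0 1) (x₀ := z0) (Metric.ball_mem_nhds _ one_pos) ?_ ?_ ?_ ?_ ?_ ?_
  · exact key.2.differentiableAt
  · exact Filter.Eventually.of_forall fun z => Continuous.aestronglyMeasurable (by fun_prop)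
  · exact Continuous.integrable_of_hasCompactSupport (by fun_prop) hs.mul_left
  · exact Continuous.aestronglyMeasurable (by fun_prop)
  · refine Filter.Eventually.of_forall fun u z hz => ?_
    rw [norm_mul, norm_mul, Complex.norm_exp]
    have hz' : ‖z‖ ≤ ‖z0‖ + 1 := by
      have h1 : ‖z - z0‖ < 1 := by simpa [dist_eq_norm] using hz
      have h2 := norm_add_le (z - z0) z0
      rw [sub_add_cancel] at h2
      linarith
    have e1 : (-2 * (Real.pi : ℂ) * (α u + z * β u) * Complex.I).re
        = 2 * Real.pi * (β u * z.im) := by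
      simp
      try ring
    have e2 : β u * z.im ≤ |β u| * (‖z0‖ + 1) := by
      calc β u * z.im ≤ |β u * z.im| := le_abs_self _
        _ = |β u| * |z.im| := abs_mul _ _
        _ ≤ _ := by
          gcongr
          exact (Complex.abs_im_le_norm z).trans hz'
    have e3 : ‖(-2 * (Real.pi : ℂ) * β u * Complex.I)‖ = 2 * Real.pi * |β u| := by
      simp [abs_of_pos Real.pi_pos]
    rw [e1, e3]
    gcongr
  · exact Continuous.integrable_of_hasCompactSupport (by fun_prop) hs.norm.mul_left
  · refine Filter.Eventually.of_forall fun u z hz => ?_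
    refine HasDerivAt.mul_const ?_ _
    refine HasDerivAt.cexp ?_
    have h := (((hasDerivAt_id z).mul_const (β u : ℂ)).const_add (α u : ℂ)).const_mul
      (-2 * (Real.pi : ℂ)) |>.mul_const Complex.I
    convert! h using 1
    simp

lemma aux_inj {d : ℕ} (f : (Fin d → ℝ) → ℂ) (hf : Continuous f) (hs : HasCompactSupport f)
    (h : ∀ x : Fin d → ℝ, ∫ u : Fin d → ℝ,
      Complex.exp ((-2 * Real.pi * ∑ i, u i * x i : ℝ) * Complex.I) * f u = 0) : f = 0 := by
  have hmp := PiLp.volume_preserving_toLp (Fin d)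
  have hme := (MeasurableEquiv.toLp 2 (Fin d → ℝ)).measurableEmbedding
  let g : EuclideanSpace ℝ (Fin d) → ℂ := fun w => f w.ofLp
  have hgc : Continuous g := hf.comp (PiLp.continuous_ofLp 2 _)
  have hgi : Integrable g := by
    rw [← hmp.integrable_comp_emb hme]
    exact hf.integrable_of_hasCompactSupport hs
  have hF : FourierTransform.fourier g = (0 : EuclideanSpace ℝ (Fin d) → ℂ) := by
    ext w
    rw [Real.fourier_eq', ← hmp.integral_comp hme]
    rw [Pi.zero_apply, ← h w.ofLp]
    congr 1
    ext u
    simp only [g, smul_eq_mul, PiLp.inner_apply, RCLike.inner_apply, conj_trivial]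
    simp only [mul_comm]
  have hinv := hgc.fourierInv_fourier_eq hgi (by rw [hF]; exact integrable_zero _ _ _)
  ext u
  have := congrFun hinv (WithLp.toLp 2 u)
  rw [hF, Real.fourierInv_eq'] at this
  simpa [g] using this.symm

lemma aux_char {m : ℕ} (S : Finset (Fin m → ℤ)) (c : (Fin m → ℤ) → ℂ)
    (h : ∀ y : Fin m → ℝ, ∑ v ∈ S,
      c v * Complex.exp ((-2 * Real.pi * ∑ i, (v i : ℝ) * y i : ℝ) * Complex.I) = 0) :
    ∀ v ∈ S, c v = 0 := by
  let χ : (Fin m → ℤ) → (Multiplicative (Fin m → ℝ) →* ℂ) := fun v =>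
    { toFun := fun y =>
        Complex.exp ((-2 * Real.pi * ∑ i, (v i : ℝ) * y.toAdd i : ℝ) * Complex.I)
      map_one' := by simp
      map_mul' := by
        intro a b
        rw [← Complex.exp_add]
        congr 1
        rw [← add_mul, ← Complex.ofReal_add, ← mul_add, ← Finset.sum_add_distrib]
        simp [mul_add] }
  have hχ : Function.Injective χ := by
    intro v w hvw
    ext i
    by_contra hne
    have hne' : ((v i : ℝ) - w i) ≠ 0 := by
      rw [sub_ne_zero]; exact_mod_cast hne
    have h1 := DFunLike.congr_fun hvw
      (Multiplicative.ofAdd (Pi.single i (1 / (2 * ((v i : ℝ) - w i)))))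
    simp only [χ, MonoidHom.coe_mk, OneHom.coe_mk, toAdd_ofAdd, Pi.single_apply, mul_ite, mul_zero,
      Finset.sum_ite_eq', Finset.mem_univ, if_true] at h1
    rw [← div_eq_one_iff_eq (Complex.exp_ne_zero _), ← Complex.exp_sub] at h1
    have h2 : ((-2 * Real.pi * (v i * (1 / (2 * ((v i : ℝ) - w i)))) : ℝ) * Complex.I
        - (-2 * Real.pi * (w i * (1 / (2 * ((v i : ℝ) - w i)))) : ℝ) * Complex.I)
        = -(Real.pi * Complex.I) := by
      rw [← sub_mul, ← Complex.ofReal_sub, ← neg_mul, ← Complex.ofReal_neg]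
      congr 2
      field_simp
      try ring
    rw [h2, Complex.exp_neg, Complex.exp_pi_mul_I] at h1
    norm_num at h1
  have hli := (linearIndependent_monoidHom (Multiplicative (Fin m → ℝ)) ℂ).comp χ hχ
  rw [linearIndependent_iff'] at hli
  refine hli S c ?_
  ext y
  simpa [χ] using h y.toAdd

/-- For `f ∈ C_c(ℝ^d × ℤ^m)` with `f ≢ 0`, the zero set of its Fourier transform
has Haar measure zero. (The Fourier transform on `ℝ^d × 𝕋^m` is represented by its
`ℤ^m`-periodic lift `f̂(x,y) = Σ_{v∈ℤ^m} ∫ e^{−2πi(u·x+v·y)} f(u,v) du` on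
`ℝ^d × ℝ^m`; its zero set is null iff the corresponding set in `ℝ^d × 𝕋^m` is null.) -/
theorem fourier_zero_set_null
    {d m : ℕ} (f : (Fin d → ℝ) → (Fin m → ℤ) → ℂ)
    (hcont : ∀ v, Continuous fun u => f u v)
    (hcs : ∀ v, HasCompactSupport fun u => f u v)
    (hfin : {v : Fin m → ℤ | (fun u => f u v) ≠ 0}.Finite)
    (hne : ∃ u v, f u v ≠ 0) :
    volume {p : (Fin d → ℝ) × (Fin m → ℝ) |
      (∑' v : Fin m → ℤ,
        ∫ u : Fin d → ℝ,
          Complex.exp ((-2 * Real.pi *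
              ((∑ i, u i * p.1 i) + ∑ i, (v i : ℝ) * p.2 i) : ℝ) * Complex.I) * f u v) = 0}
      = 0 := by
  classical
  set S := hfin.toFinset with hS
  let T : (Fin m → ℤ) → (Fin d → ℝ) × (Fin m → ℝ) → ℂ := fun v p =>
    ∫ u : Fin d → ℝ,
          Complex.exp ((-2 * Real.pi *
              ((∑ i, u i * p.1 i) + ∑ i, (v i : ℝ) * p.2 i) : ℝ) * Complex.I) * f u v
  let G : (Fin d → ℝ) × (Fin m → ℝ) → ℂ := fun p => ∑ v ∈ S, T v p
  have hfv : ∀ v, v ∉ S → ∀ u, f u v = 0 := by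
    intro v hv u
    have : (fun u => f u v) = 0 := by simpa [hS] using hv
    exact congrFun this u
  have hG : ∀ p, (∑' v, T v p) = G p := by
    intro p
    refine tsum_eq_sum fun v hv => ?_
    simp [T, hfv v hv]
  change volume {p | (∑' v, T v p) = 0} = 0
  simp only [hG]
  have hGc : Continuous G := by
    refine continuous_finsetSum _ fun v _ => ?_
    refine continuous_of_dominated (bound := fun u => ‖f u v‖) ?_ ?_ ?_ ?_
    · have := hcont v
      exact fun p => Continuous.aestronglyMeasurable (by fun_prop)
    · refine fun p => Filter.Eventually.of_forall fun u => ?_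
      rw [norm_mul, Complex.norm_exp_ofReal_mul_I, one_mul]
    · exact ((hcont v).integrable_of_hasCompactSupport (hcs v)).norm
    · exact Filter.Eventually.of_forall fun u => by fun_prop
  have hex : ∃ p, G p ≠ 0 := by
    by_contra! hz
    obtain ⟨u0, v0, h0⟩ := hne
    apply h0
    by_cases hv0 : v0 ∈ S
    · refine congrFun (aux_inj (fun u => f u v0) (hcont v0) (hcs v0) fun x => ?_) u0
      refine aux_char S (fun v => ∫ u : Fin d → ℝ,
        Complex.exp ((-2 * Real.pi * ∑ i, u i * x i : ℝ) * Complex.I) * f u v) (fun y => ?_) v0 hv0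
      rw [← hz (x, y)]
      refine Finset.sum_congr rfl fun v _ => ?_
      rw [← integral_mul_const]
      refine integral_congr_ae (Filter.Eventually.of_forall fun u => ?_)
      simp only [mul_add, Complex.ofReal_add, add_mul, Complex.exp_add]
      ring
    · exact hfv v0 hv0 u0
  obtain ⟨x0, hx0⟩ := hex
  haveI : (volume : Measure ((Fin d → ℝ) × (Fin m → ℝ))).IsAddHaarMeasure :=
    Measure.prod.instIsAddHaarMeasure (volume : Measure (Fin d → ℝ)) (volume : Measure (Fin m → ℝ))
  refine aux_null volume G hGc x0 hx0 fun x t => ?_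
  have hd : Differentiable ℂ (fun z : ℂ => ∑ v ∈ S, ∫ u : Fin d → ℝ,
      Complex.exp (-2 * Real.pi * (((∑ i, u i * x0.1 i) + ∑ i, (v i : ℝ) * x0.2 i : ℝ) +
        z * ((∑ i, u i * x.1 i) + ∑ i, (v i : ℝ) * x.2 i : ℝ)) * Complex.I) * f u v) := by
    refine Differentiable.fun_sum fun v _ => ?_
    exact aux_diff (fun u => f u v) (hcont v) (hcs v) _ _ (by fun_prop) (by fun_prop)
  have ha := ((hd.analyticAt (t : ℂ)).restrictScalars (𝕜 := ℝ)).comp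
    (Complex.ofRealCLM.analyticAt t)
  convert! ha using 1
  ext s
  refine Finset.sum_congr rfl fun v _ => ?_
  refine integral_congr_ae (Filter.Eventually.of_forall fun u => ?_)
  have : (-2 * Real.pi * ((∑ i, u i * (x0 + s • x).1 i) + ∑ i, (v i : ℝ) * (x0 + s • x).2 i))
      = -2 * Real.pi * (((∑ i, u i * x0.1 i) + ∑ i, (v i : ℝ) * x0.2 i) +
        s * ((∑ i, u i * x.1 i) + ∑ i, (v i : ℝ) * x.2 i)) := by
    congr 1
    simp only [Prod.fst_add, Prod.snd_add, Prod.smul_fst, Prod.smul_snd, Pi.add_apply,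
      Pi.smul_apply, smul_eq_mul, mul_add, Finset.sum_add_distrib, Finset.mul_sum]
    simp only [mul_left_comm s]
    ring
  simp only [this]
  congr 2
  simp
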